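/- Let M ⊆ F be a finitely generated graded A-module whose initial module in_{(ω,ε)}(M) is componentwise linear. If β_1(M) = β_1(in_{(ω,ε)}(M)), then β_0(M) = β_0(in_{(ω,ε)}(M)) and M is componentwise linear. -/

import Mathlib

/-!  Basic setup: the polynomial ring `A = K[X_1,…,X_n]`, a graded free module
`F = ⊕_{j} A(-d_j)` realized as `Fin k → A`, weight orders `(ω, ε)`, initial
modules, Hilbert functions, graded free resolutions, Betti numbers,
regularity and componentwise notions, following Caviglia–Varbaro,
"Componentwise regularity (I)". -/

namespace CregPaper

abbrev A (K : Type*) [Field K] (n : ℕ) := MvPolynomial (Fin n) K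

variable {K : Type*} [Field K] {n k : ℕ}

/-- `(ω)`-weight of an exponent vector `u`. -/
def wdeg (ω : Fin n → ℕ) (u : Fin n →₀ ℕ) : ℕ := u.sum fun i e => ω i * e

/-- total (standard) degree of an exponent vector `u`. -/
def tdeg (u : Fin n →₀ ℕ) : ℕ := u.sum fun _ e => e

/-- largest `(ω,ε)`-weight of a monomial in the support of `f ∈ F`. -/
noncomputable def maxWt (ω : Fin n → ℕ) (ε : Fin k → ℕ) (f : Fin k → A K n) : ℕ :=
  Finset.univ.sup fun j => (f j).support.sup fun u => wdeg ω u + ε j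

/-- the initial part `in_{(ω,ε)}(f)`: the sum of the terms of `f` of largest weight. -/
noncomputable def inForm (ω : Fin n → ℕ) (ε : Fin k → ℕ) (f : Fin k → A K n) :
    Fin k → A K n :=
  fun j => ∑ u ∈ (f j).support.filter fun u => wdeg ω u + ε j = maxWt ω ε f,
    MvPolynomial.monomial u ((f j).coeff u)

/-- the initial module `in_{(ω,ε)}(M)`. -/
noncomputable def inMod (ω : Fin n → ℕ) (ε : Fin k → ℕ)
    (M : Submodule (A K n) (Fin k → A K n)) : Submodule (A K n) (Fin k → A K n) :=
  Submodule.span (A K n) {g | ∃ f ∈ M, f ≠ 0 ∧ g = inForm ω ε f}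

/-- `f ∈ F = ⊕_j A(-d_j)` is homogeneous of (standard) degree `a`. -/
def IsHomog (d : Fin k → ℕ) (a : ℕ) (f : Fin k → A K n) : Prop :=
  ∀ j, ∀ u ∈ (f j).support, tdeg u + d j = a

/-- the `K`-subspace of `F` of homogeneous elements of degree `a`. -/
noncomputable def homogSub (d : Fin k → ℕ) (a : ℕ) : Submodule K (Fin k → A K n) where
  carrier := {f | IsHomog d a f}
  add_mem' := by
    intro f g hf hg j u hu
    rcases Finset.mem_union.mp (MvPolynomial.support_add hu) with h | h
    · exact hf j u h
    · exact hg j u h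
  zero_mem' := by intro j u hu; simp at hu
  smul_mem' := by
    intro c f hf j u hu
    exact hf j u (MvPolynomial.support_smul hu)

/-- the degree-`a` homogeneous component of `f ∈ F`. -/
noncomputable def homogComp (d : Fin k → ℕ) (f : Fin k → A K n) (a : ℕ) : Fin k → A K n :=
  fun j => ∑ u ∈ (f j).support.filter fun u => tdeg u + d j = a,
    MvPolynomial.monomial u ((f j).coeff u)

/-- `M ⊆ F` is a graded submodule. -/
def IsGradedSub (d : Fin k → ℕ) (M : Submodule (A K n) (Fin k → A K n)) : Prop :=
  ∀ f ∈ M, ∀ a, homogComp d f a ∈ M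

/-- Hilbert function of `M ⊆ F` in degree `a`. -/
noncomputable def hilb (d : Fin k → ℕ) (M : Submodule (A K n) (Fin k → A K n)) (a : ℕ) : ℕ :=
  Module.finrank K ↥(Submodule.restrictScalars K M ⊓ homogSub d a)

/-- the homogeneous maximal ideal `m = (X_1,…,X_n)` of `A`. -/
noncomputable def mIdeal (K : Type*) [Field K] (n : ℕ) : Ideal (A K n) :=
  RingHom.ker (MvPolynomial.constantCoeff : A K n →+* K)

/-- graded Betti number `β_{0,a}(M) = dim_K (M/mM)_a`, the number of minimal
generators of the graded module `M` in degree `a`. -/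
noncomputable def beta0 (d : Fin k → ℕ) (M : Submodule (A K n) (Fin k → A K n)) (a : ℕ) : ℕ :=
  hilb d M a - hilb d (mIdeal K n • M) a

/-- A graded free resolution of a graded submodule `M` of `F = ⊕_j A(-d_j)`:
`⋯ → A^{rk 1} → A^{rk 0} → M → 0`, each free module coming with degree shifts
`sh i`, all maps graded of degree `0`. -/
structure GFRes (d : Fin k → ℕ) (M : Submodule (A K n) (Fin k → A K n)) where
  rk : ℕ → ℕ
  sh : (i : ℕ) → Fin (rk i) → ℕ
  aug : (Fin (rk 0) → A K n) →ₗ[A K n] (Fin k → A K n)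
  diff : (i : ℕ) → ((Fin (rk (i+1)) → A K n) →ₗ[A K n] (Fin (rk i) → A K n))
  aug_range : LinearMap.range aug = M
  aug_hom : ∀ l, IsHomog d (sh 0 l) (aug (Pi.single l 1))
  diff_hom : ∀ i l, IsHomog (sh i) (sh (i+1) l) (diff i (Pi.single l 1))
  ex0 : LinearMap.range (diff 0) = LinearMap.ker aug
  exs : ∀ i, LinearMap.range (diff (i+1)) = LinearMap.ker (diff i)

/-- minimality of a graded free resolution: all entries of the differential
matrices lie in the maximal ideal. -/
def GFRes.Minimal {d : Fin k → ℕ} {M : Submodule (A K n) (Fin k → A K n)}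
    (res : GFRes d M) : Prop :=
  ∀ i x l, res.diff i x l ∈ mIdeal K n

/-- the graded Betti number `β_{i,j}(M)` read off from a (minimal) resolution. -/
noncomputable def GFRes.betti {d : Fin k → ℕ} {M : Submodule (A K n) (Fin k → A K n)}
    (res : GFRes d M) (i j : ℕ) : ℕ :=
  (Finset.univ.filter fun l => res.sh i l = j).card

/-- `reg_A(M) ≤ r`: there is a minimal graded free resolution of `M` with
all shifts in homological degree `i` bounded by `i + r`. -/
def RegLE (d : Fin k → ℕ) (M : Submodule (A K n) (Fin k → A K n)) (r : ℕ) : Prop :=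
  ∃ res : GFRes d M, res.Minimal ∧ ∀ i l, res.sh i l ≤ i + r

/-- `M_{⟨a⟩}`: the submodule generated by the homogeneous elements of degree `a` of `M`. -/
noncomputable def compSub (d : Fin k → ℕ) (M : Submodule (A K n) (Fin k → A K n)) (a : ℕ) :
    Submodule (A K n) (Fin k → A K n) :=
  Submodule.span (A K n) {f | f ∈ M ∧ IsHomog d a f}

/-- `M` is `r`-componentwise regular: `reg (M_{⟨a⟩}) ≤ a + r` for all `a`. -/
def CWRegLE (d : Fin k → ℕ) (M : Submodule (A K n) (Fin k → A K n)) (r : ℕ) : Prop :=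
  ∀ a, RegLE d (compSub d M a) (a + r)

/-- `M` is componentwise linear: each `M_{⟨a⟩}` is zero or has regularity `a`. -/
def CompLinear (d : Fin k → ℕ) (M : Submodule (A K n) (Fin k → A K n)) : Prop :=
  ∀ a, compSub d M a = ⊥ ∨ RegLE d (compSub d M a) a

/-- `M` is generated in degrees `≤ a`. -/
def GenInDegLE (d : Fin k → ℕ) (M : Submodule (A K n) (Fin k → A K n)) (a : ℕ) : Prop :=
  M ≤ Submodule.span (A K n) {f | f ∈ M ∧ ∃ b ≤ a, IsHomog d b f}

end CregPaper

namespace CregPaper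

section Gradings

variable {K : Type*} [Field K] {n k r : ℕ}

theorem wdeg_add (ω : Fin n → ℕ) (u v : Fin n →₀ ℕ) :
    wdeg ω (u + v) = wdeg ω u + wdeg ω v := by
  unfold wdeg
  exact Finsupp.sum_add_index' (by simp) (by intros; ring)

@[simp] theorem wdeg_zero (ω : Fin n → ℕ) : wdeg ω 0 = 0 := by simp [wdeg]

theorem wdeg_one (u : Fin n →₀ ℕ) : wdeg 1 u = tdeg u := by
  simp [wdeg, tdeg]

theorem eq_zero_of_wdeg_one {u : Fin n →₀ ℕ} (h : wdeg 1 u = 0) : u = 0 := by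
  ext i
  by_contra hi
  have : i ∈ u.support := by simpa using hi
  simp only [wdeg, Finsupp.sum, Finset.sum_eq_zero_iff] at h
  exact hi (by simpa using h i this)

theorem coeff_sum_filter_monomial (p : A K n) (P : (Fin n →₀ ℕ) → Prop) [DecidablePred P]
    (m : Fin n →₀ ℕ) :
    (∑ u ∈ p.support.filter P, MvPolynomial.monomial u (p.coeff u)).coeff m =
      if P m then p.coeff m else 0 := by
  classical
  simp only [MvPolynomial.coeff_sum, MvPolynomial.coeff_monomial, Finset.sum_ite_eq',
    Finset.mem_filter, MvPolynomial.mem_support_iff]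
  by_cases h : P m <;> simp +contextual [h, eq_comm]

/-- The component of `f` in degree `w` for the grading given by the weights `ω` of the variables
and the shifts `ε` of the basis vectors. -/
noncomputable def wcomp (ω : Fin n → ℕ) (ε : Fin k → ℕ) (w : ℕ) :
    (Fin k → A K n) →ₗ[K] (Fin k → A K n) where
  toFun f := fun j => ∑ u ∈ (f j).support.filter fun u => wdeg ω u + ε j = w,
    MvPolynomial.monomial u ((f j).coeff u)
  map_add' f g := by
    ext j m
    refine (coeff_sum_filter_monomial _ _ m).trans ?_
    refine Eq.trans ?_ (MvPolynomial.coeff_add _ _ _).symm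
    rw [coeff_sum_filter_monomial, coeff_sum_filter_monomial]
    split_ifs <;> simp
  map_smul' c f := by
    ext j m
    refine (coeff_sum_filter_monomial _ _ m).trans ?_
    refine Eq.trans ?_ (MvPolynomial.coeff_smul _ _ _).symm
    rw [coeff_sum_filter_monomial]
    split_ifs <;> simp

theorem coeff_wcomp (ω : Fin n → ℕ) (ε : Fin k → ℕ) (w : ℕ) (f : Fin k → A K n) (j : Fin k)
    (u : Fin n →₀ ℕ) :
    (wcomp ω ε w f j).coeff u = if wdeg ω u + ε j = w then (f j).coeff u else 0 :=
  coeff_sum_filter_monomial (f j) (fun u => wdeg ω u + ε j = w) u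

theorem homogComp_eq_wcomp (d : Fin k → ℕ) (f : Fin k → A K n) (a : ℕ) :
    homogComp d f a = wcomp 1 d a f := by
  funext j
  simp [homogComp, wcomp, wdeg_one]

/-- `f` is homogeneous of degree `w` for the grading given by `ω` and `ε`. -/
def WHom (ω : Fin n → ℕ) (ε : Fin k → ℕ) (w : ℕ) (f : Fin k → A K n) : Prop :=
  ∀ j u, (f j).coeff u ≠ 0 → wdeg ω u + ε j = w

theorem isHomog_iff {d : Fin k → ℕ} {a : ℕ} {f : Fin k → A K n} :
    IsHomog d a f ↔ WHom 1 d a f := by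
  simp [IsHomog, WHom, wdeg_one]

/-- The elements of the free module all of whose terms have weight less than `w`. -/
def Fil (ω : Fin n → ℕ) (ε : Fin k → ℕ) (w : ℕ) : Submodule K (Fin k → A K n) where
  carrier := {f | ∀ j u, (f j).coeff u ≠ 0 → wdeg ω u + ε j < w}
  add_mem' := by
    intro f g hf hg j u h
    by_cases h1 : (f j).coeff u = 0
    · exact hg j u (by simpa [h1] using h)
    · exact hf j u h1
  zero_mem' := by intro j u h; simp at h
  smul_mem' := by
    intro c f hf j u h
    refine hf j u fun h0 => h ?_
    simp [h0]

theorem mem_Fil {ω : Fin n → ℕ} {ε : Fin k → ℕ} {w : ℕ} {f : Fin k → A K n} :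
    f ∈ Fil ω ε w ↔ ∀ j u, (f j).coeff u ≠ 0 → wdeg ω u + ε j < w := Iff.rfl

variable {ω ω' : Fin n → ℕ} {ε ε' : Fin k → ℕ} {w w' : ℕ} {f : Fin k → A K n}

theorem wcomp_comm : wcomp ω ε w (wcomp ω' ε' w' f) = wcomp ω' ε' w' (wcomp ω ε w f) := by
  ext j u
  simp only [coeff_wcomp]
  split_ifs <;> rfl

theorem wcomp_mem_Fil (h : f ∈ Fil ω ε w) : wcomp ω' ε' w' f ∈ Fil ω ε w := by
  intro j u hu
  rw [coeff_wcomp] at hu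
  exact h j u (by aesop)

theorem WHom.wcomp (h : WHom ω ε w f) : WHom ω ε w (wcomp ω' ε' w' f) := by
  intro j u hu
  rw [coeff_wcomp] at hu
  exact h j u (by aesop)

theorem WHom_wcomp : WHom ω ε w (wcomp ω ε w f) := by
  intro j u hu
  rw [coeff_wcomp] at hu
  by_contra h
  simp [h] at hu

theorem WHom.mem_Fil (h : WHom ω ε w f) : f ∈ Fil ω ε (w + 1) := by
  intro j u hu
  have := h j u hu
  omega

theorem WHom.wcomp_eq (h : WHom ω ε w f) :
    CregPaper.wcomp ω ε w' f = if w = w' then f else 0 := by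
  ext j u
  rw [coeff_wcomp]
  by_cases h0 : (f j).coeff u = 0
  · split_ifs <;> simp [h0]
  · rw [h j u h0]
    split_ifs <;> simp

theorem WHom.wcomp_self (h : WHom ω ε w f) : CregPaper.wcomp ω ε w f = f := by
  simp [h.wcomp_eq]

theorem WHom.sub {g : Fin k → A K n} (hf : WHom ω ε w f) (hg : WHom ω ε w g) :
    WHom ω ε w (f - g) := by
  rw [← hf.wcomp_self, ← hg.wcomp_self, ← map_sub]
  exact WHom_wcomp

theorem Fil_zero (h : f ∈ Fil ω ε 0) : f = 0 := by
  ext j u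
  by_contra hu
  exact absurd (h j u hu) (by simp)

theorem Fil_mono (h : w ≤ w') (hf : f ∈ Fil ω ε w) : f ∈ Fil ω ε w' :=
  fun j u hu => (hf j u hu).trans_le h

theorem wcomp_eq_zero (hf : f ∈ Fil ω ε w) : wcomp ω ε w f = 0 := by
  ext j u
  rw [coeff_wcomp]
  split_ifs with h
  · by_contra hu
    exact absurd (hf j u hu) (by omega)
  · simp

theorem mem_Fil_of_wcomp_eq_zero (hf : f ∈ Fil ω ε (w + 1)) (h : wcomp ω ε w f = 0) :
    f ∈ Fil ω ε w := by
  intro j u hu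
  have h1 := hf j u hu
  have h2 := coeff_wcomp ω ε w f j u
  rw [h] at h2
  by_contra h3
  rw [if_pos (by omega)] at h2
  exact hu (by simpa using h2.symm)

theorem mem_Fil_maxWt (ω : Fin n → ℕ) (ε : Fin k → ℕ) (f : Fin k → A K n) :
    f ∈ Fil ω ε (maxWt ω ε f + 1) := by
  intro j u hu
  refine Nat.lt_succ_of_le ?_
  exact (Finset.le_sup (f := fun u => wdeg ω u + ε j) (by simpa using hu)).trans
    (Finset.le_sup (f := fun j => (f j).support.sup fun u => wdeg ω u + ε j)
      (Finset.mem_univ j))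

theorem exists_mem_Fil (ω : Fin n → ℕ) (ε : Fin k → ℕ) (f : Fin k → A K n) :
    ∃ w, f ∈ Fil ω ε w :=
  ⟨_, mem_Fil_maxWt ω ε f⟩

theorem sub_wcomp_mem_Fil (hf : f ∈ Fil ω ε (w + 1)) : f - wcomp ω ε w f ∈ Fil ω ε w := by
  refine mem_Fil_of_wcomp_eq_zero (Submodule.sub_mem _ hf (wcomp_mem_Fil hf)) ?_
  rw [map_sub, WHom_wcomp.wcomp_self, sub_self]

/-- An element lies in an additive subgroup as soon as its components do. -/
theorem mem_of_wcomp_mem (ω : Fin n → ℕ) (ε : Fin k → ℕ) {f : Fin k → A K n}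
    {S : Type*} [SetLike S (Fin k → A K n)] [AddSubmonoidClass S (Fin k → A K n)] {N : S}
    (h : ∀ w, wcomp ω ε w f ∈ N) : f ∈ N := by
  obtain ⟨W, hW⟩ := exists_mem_Fil ω ε f
  induction W generalizing f with
  | zero => rw [Fil_zero hW]; exact zero_mem N
  | succ W ih =>
    have := ih (f := f - wcomp ω ε W f) (fun w => ?_) (sub_wcomp_mem_Fil hW)
    · simpa using add_mem this (h W)
    · rw [map_sub, (WHom_wcomp (f := f) (w := W)).wcomp_eq]
      split_ifs with hw
      · subst hw; simp
      · simpa using h w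

theorem eq_sum_smul_single (c : Fin r → A K n) : c = ∑ l, c l • Pi.single l (1 : A K n) := by
  classical
  ext1 i
  simp [Finset.sum_apply, Pi.single_apply]

theorem exists_coeff_of_map {m : ℕ} {φ : (Fin r → A K n) →ₗ[A K n] (Fin m → A K n)}
    {c : Fin r → A K n} {j : Fin m} {u : Fin n →₀ ℕ} (h : (φ c j).coeff u ≠ 0) :
    ∃ l u₁ u₂, u = u₁ + u₂ ∧ (c l).coeff u₁ ≠ 0 ∧ (φ (Pi.single l 1) j).coeff u₂ ≠ 0 := by
  classical
  rw [eq_sum_smul_single c, map_sum, Finset.sum_apply, MvPolynomial.coeff_sum] at h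
  obtain ⟨l, -, hl⟩ := Finset.exists_ne_zero_of_sum_ne_zero h
  rw [map_smul, Pi.smul_apply, smul_eq_mul, MvPolynomial.coeff_mul] at hl
  obtain ⟨x, hx, hx0⟩ := Finset.exists_ne_zero_of_sum_ne_zero hl
  exact ⟨l, x.1, x.2, (Finset.HasAntidiagonal.mem_antidiagonal.mp hx).symm, left_ne_zero_of_mul hx0,
    right_ne_zero_of_mul hx0⟩

section Maps

variable {m : ℕ} {φ φ₀ : (Fin r → A K n) →ₗ[A K n] (Fin m → A K n)} {η : Fin r → ℕ}
  {ε : Fin m → ℕ} {c : Fin r → A K n}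

theorem WHom.map (hφ : ∀ l, WHom ω ε (η l) (φ (Pi.single l 1))) (hc : WHom ω η w c) :
    WHom ω ε w (φ c) := by
  intro j u hu
  obtain ⟨l, u₁, u₂, rfl, h1, h2⟩ := exists_coeff_of_map hu
  have := hc l u₁ h1
  have := hφ l j u₂ h2
  rw [wdeg_add]
  omega

theorem map_mem_Fil (hφ : ∀ l, φ (Pi.single l 1) ∈ Fil ω ε (η l + 1)) (hc : c ∈ Fil ω η w) :
    φ c ∈ Fil ω ε w := by
  intro j u hu
  obtain ⟨l, u₁, u₂, rfl, h1, h2⟩ := exists_coeff_of_map hu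
  have := hc l u₁ h1
  have := hφ l j u₂ h2
  rw [wdeg_add]
  omega

theorem klinear_ext {V : Type*} [AddCommGroup V] [Module K V]
    {α β : (Fin r → A K n) →ₗ[K] V}
    (h : ∀ l u, α (Pi.single l (MvPolynomial.monomial u 1)) =
      β (Pi.single l (MvPolynomial.monomial u 1))) : α = β := by
  refine LinearMap.pi_ext fun l p => ?_
  induction p using MvPolynomial.induction_on' with
  | monomial u a =>
    have : (MvPolynomial.monomial u a : A K n) = a • MvPolynomial.monomial u 1 := by
      rw [MvPolynomial.smul_monomial]; simp
    rw [this, Pi.single_smul, map_smul, map_smul, h]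
  | add p q hp hq => rw [Pi.single_add, map_add, map_add, hp, hq]

theorem WHom_single (l : Fin r) (u : Fin n →₀ ℕ) :
    WHom ω η (wdeg ω u + η l) (Pi.single l (MvPolynomial.monomial u (1 : K))) := by
  classical
  intro j v hv
  rcases eq_or_ne j l with rfl | hj
  · rw [Pi.single_eq_same, MvPolynomial.coeff_monomial] at hv
    by_cases h : u = v
    · rw [h]
    · simp [h] at hv
  · simp [Pi.single_eq_of_ne hj] at hv

theorem wcomp_monomial_smul (u : Fin n →₀ ℕ) (a : K) (w : ℕ) (f : Fin m → A K n) :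
    wcomp ω ε (wdeg ω u + w) (MvPolynomial.monomial u a • f) =
      MvPolynomial.monomial u a • wcomp ω ε w f := by
  ext j v
  rw [coeff_wcomp]
  simp only [Pi.smul_apply, smul_eq_mul, MvPolynomial.coeff_monomial_mul']
  split_ifs with h1 h2 h2
  · rw [coeff_wcomp, if_pos]
    have := wdeg_add ω u (v - u)
    rw [add_tsub_cancel_of_le h2] at this
    omega
  · rfl
  · rw [coeff_wcomp, if_neg, mul_zero]
    have := wdeg_add ω u (v - u)
    rw [add_tsub_cancel_of_le h2] at this
    omega
  · rfl

theorem monomial_smul_mem_Fil {u : Fin n →₀ ℕ} {a : K} {w : ℕ} {f : Fin m → A K n}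
    (hf : f ∈ Fil ω ε w) : MvPolynomial.monomial u a • f ∈ Fil ω ε (wdeg ω u + w) := by
  intro j v hv
  simp only [Pi.smul_apply, smul_eq_mul, MvPolynomial.coeff_monomial_mul'] at hv
  split_ifs at hv with h
  · have h1 := hf j _ (right_ne_zero_of_mul hv)
    have := wdeg_add ω u (v - u)
    rw [add_tsub_cancel_of_le h] at this
    omega
  · exact absurd rfl hv

theorem wcomp_map (hφ : ∀ l, WHom ω ε (η l) (φ (Pi.single l 1))) (w : ℕ) (c : Fin r → A K n) :
    wcomp ω ε w (φ c) = φ (wcomp ω η w c) := by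
  have : wcomp ω ε w ∘ₗ φ.restrictScalars K = φ.restrictScalars K ∘ₗ wcomp ω η w := by
    refine klinear_ext fun l u => ?_
    simp only [LinearMap.comp_apply, LinearMap.restrictScalars_apply]
    have h := WHom_single (K := K) (ω := ω) (η := η) l u
    rw [h.wcomp_eq, (h.map hφ).wcomp_eq]
    split_ifs <;> simp
  exact LinearMap.congr_fun this c

theorem single_monomial (l : Fin r) (u : Fin n →₀ ℕ) :
    (Pi.single l (MvPolynomial.monomial u (1 : K)) : Fin r → A K n) =
      MvPolynomial.monomial u (1 : K) • Pi.single l 1 := by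
  rw [← Pi.single_smul, smul_eq_mul, mul_one]

theorem wcomp_map_of_Fil (hφ : ∀ l, φ (Pi.single l 1) ∈ Fil ω ε (η l + 1))
    (hφ₀ : ∀ l, φ₀ (Pi.single l 1) = wcomp ω ε (η l) (φ (Pi.single l 1)))
    (hc : c ∈ Fil ω η (w + 1)) : wcomp ω ε w (φ c) = φ₀ (wcomp ω η w c) := by
  have h1 : wcomp ω ε w (φ c) = wcomp ω ε w (φ (wcomp ω η w c)) := by
    rw [← sub_eq_zero, ← map_sub, ← map_sub]
    exact wcomp_eq_zero (map_mem_Fil hφ (sub_wcomp_mem_Fil hc))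
  have h2 : wcomp ω ε w ∘ₗ φ.restrictScalars K ∘ₗ wcomp ω η w =
      φ₀.restrictScalars K ∘ₗ wcomp ω η w := by
    refine klinear_ext fun l u => ?_
    simp only [LinearMap.comp_apply, LinearMap.restrictScalars_apply]
    rw [(WHom_single l u).wcomp_eq]
    split_ifs with h
    · rw [← h, single_monomial, φ.map_smul, φ₀.map_smul, hφ₀, wcomp_monomial_smul]
    · simp
  rw [h1]
  exact LinearMap.congr_fun h2 c

end Maps

end Gradings

section InitialModules

variable {K : Type*} [Field K] {n k r : ℕ} {ω : Fin n → ℕ} {d ε : Fin k → ℕ}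
  {M : Submodule (A K n) (Fin k → A K n)} {f x : Fin k → A K n} {a w : ℕ}

theorem IsGradedSub.wcomp_mem (hM : IsGradedSub d M) (hf : f ∈ M) (a : ℕ) :
    wcomp 1 d a f ∈ M := by
  rw [← homogComp_eq_wcomp]
  exact hM f hf a

theorem maxWt_spec (hf : f ∈ Fil ω ε (w + 1)) (h0 : wcomp ω ε w f ≠ 0) : maxWt ω ε f = w := by
  apply le_antisymm
  · refine Finset.sup_le fun j _ => Finset.sup_le fun u hu => ?_
    exact Nat.lt_succ_iff.mp (hf j u (by simpa using hu))
  · by_contra! h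
    refine h0 (wcomp_eq_zero fun j u hu => lt_of_le_of_lt ?_ h)
    exact (Finset.le_sup (f := fun u => wdeg ω u + ε j) (by simpa using hu)).trans
      (Finset.le_sup (f := fun j => (f j).support.sup fun u => wdeg ω u + ε j)
        (Finset.mem_univ j))

theorem inForm_eq_wcomp : inForm ω ε f = wcomp ω ε (maxWt ω ε f) f := rfl

theorem wcomp_mem_inMod (hf : f ∈ M) (hw : f ∈ Fil ω ε (w + 1)) :
    wcomp ω ε w f ∈ inMod ω ε M := by
  by_cases h0 : wcomp ω ε w f = 0
  · rw [h0]; exact zero_mem _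
  · refine Submodule.subset_span ⟨f, hf, fun h => h0 (by rw [h, map_zero]), ?_⟩
    rw [inForm_eq_wcomp, maxWt_spec hw h0]

/-- An element lies in the initial module iff each of its components is the component of top
weight of an element of the module. -/
theorem mem_inMod : x ∈ inMod ω ε M ↔
    ∀ w, ∃ f ∈ M, f ∈ Fil ω ε (w + 1) ∧ wcomp ω ε w f = wcomp ω ε w x := by
  constructor
  · intro hx
    induction hx using Submodule.span_induction with
    | mem x hx =>
      obtain ⟨f, hf, -, rfl⟩ := hx
      intro w
      rw [inForm_eq_wcomp, WHom_wcomp.wcomp_eq]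
      split_ifs with h
      · exact ⟨f, hf, h ▸ mem_Fil_maxWt ω ε f, by rw [h]⟩
      · exact ⟨0, zero_mem _, zero_mem _, map_zero _⟩
    | zero => exact fun w => ⟨0, zero_mem _, zero_mem _, rfl⟩
    | add x y _ _ hx hy =>
      intro w
      obtain ⟨f, hf, hf', hfx⟩ := hx w
      obtain ⟨g, hg, hg', hgy⟩ := hy w
      exact ⟨f + g, add_mem hf hg, add_mem hf' hg', by rw [map_add, map_add, hfx, hgy]⟩
    | smul p x _ hx =>
      induction p using MvPolynomial.induction_on' with
      | monomial u b =>
        intro w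
        by_cases h : wdeg ω u ≤ w
        · obtain ⟨v, rfl⟩ := Nat.exists_eq_add_of_le h
          obtain ⟨f, hf, hf', hfx⟩ := hx v
          refine ⟨_, Submodule.smul_mem _ (MvPolynomial.monomial u b) hf,
            monomial_smul_mem_Fil hf', ?_⟩
          rw [wcomp_monomial_smul, wcomp_monomial_smul, hfx]
        · refine ⟨0, zero_mem _, zero_mem _, ?_⟩
          rw [map_zero]
          ext j v
          rw [coeff_wcomp]
          split_ifs with hv
          · rw [Pi.smul_apply, smul_eq_mul, MvPolynomial.coeff_monomial_mul', if_neg]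
            · rfl
            · intro huv
              have := wdeg_add ω u (v - u)
              rw [add_tsub_cancel_of_le huv] at this
              omega
          · rfl
      | add p q hp hq =>
        intro w
        obtain ⟨f, hf, hf', hfx⟩ := hp w
        obtain ⟨g, hg, hg', hgy⟩ := hq w
        exact ⟨f + g, add_mem hf hg, add_mem hf' hg', by rw [map_add, add_smul, map_add, hfx, hgy]⟩
  · intro h
    refine mem_of_wcomp_mem ω ε fun w => ?_
    obtain ⟨f, hf, hf', hfx⟩ := h w
    rw [← hfx]
    exact wcomp_mem_inMod hf hf'

theorem IsGradedSub.inMod (hM : IsGradedSub d M) : IsGradedSub d (inMod ω ε M) := by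
  intro x hx a
  rw [homogComp_eq_wcomp]
  refine mem_inMod.mpr fun w => ?_
  obtain ⟨f, hf, hf', hfx⟩ := mem_inMod.mp hx w
  exact ⟨_, hM.wcomp_mem hf a, wcomp_mem_Fil hf', by rw [wcomp_comm, hfx, wcomp_comm]⟩

/-- The initial parts of the homogeneous elements of `M` of degree `a`. -/
def initParts (ω : Fin n → ℕ) (d ε : Fin k → ℕ) (M : Submodule (A K n) (Fin k → A K n)) (a : ℕ) :
    Set (Fin k → A K n) :=
  {x | ∃ w, ∃ f ∈ M, WHom 1 d a f ∧ f ∈ Fil ω ε (w + 1) ∧ x = wcomp ω ε w f}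

theorem wcomp_mem_initParts (hM : IsGradedSub d M) (hx : x ∈ inMod ω ε M) (hxa : WHom 1 d a x)
    (w : ℕ) : wcomp ω ε w x ∈ initParts ω d ε M a := by
  obtain ⟨f, hf, hf', hfx⟩ := mem_inMod.mp hx w
  refine ⟨w, _, hM.wcomp_mem hf a, WHom_wcomp, wcomp_mem_Fil hf', ?_⟩
  rw [wcomp_comm, hfx, wcomp_comm, hxa.wcomp_self]

theorem initParts_subset : initParts ω d ε M a ⊆ {x | x ∈ inMod ω ε M ∧ WHom 1 d a x} := by
  rintro _ ⟨w, f, hf, hfa, hfw, rfl⟩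
  exact ⟨wcomp_mem_inMod hf hfw, hfa.wcomp⟩

theorem mem_span_initParts (hM : IsGradedSub d M) (hx : x ∈ inMod ω ε M) (hxa : WHom 1 d a x) :
    x ∈ Submodule.span (A K n) (initParts ω d ε M a) :=
  mem_of_wcomp_mem ω ε fun w => Submodule.subset_span (wcomp_mem_initParts hM hx hxa w)

theorem span_iUnion_initParts (hM : IsGradedSub d M) :
    Submodule.span (A K n) (⋃ a, initParts ω d ε M a) = inMod ω ε M := by
  apply le_antisymm
  · exact Submodule.span_le.mpr (Set.iUnion_subset fun a x hx => (initParts_subset hx).1)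
  · intro x hx
    refine mem_of_wcomp_mem 1 d fun a => ?_
    refine Submodule.span_mono (Set.subset_iUnion _ a) (mem_span_initParts hM ?_ WHom_wcomp)
    exact hM.inMod.wcomp_mem hx a

theorem compSub_inMod (hM : IsGradedSub d M) :
    compSub d (inMod ω ε M) a = Submodule.span (A K n) (initParts ω d ε M a) := by
  apply le_antisymm
  · refine Submodule.span_le.mpr fun x hx => ?_
    exact mem_span_initParts hM hx.1 (isHomog_iff.mp hx.2)
  · refine Submodule.span_mono fun x hx => ?_
    exact ⟨(initParts_subset hx).1, isHomog_iff.mpr (initParts_subset hx).2⟩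

/-- `φ` is a graded map of free modules sending the `l`-th basis vector to an element whose terms
have weight at most `ε' l`, and `φ₀` sends it to the part of weight `ε' l` of that element. -/
structure IsLift (ω : Fin n → ℕ) (d ε : Fin k → ℕ) (d' ε' : Fin r → ℕ)
    (φ φ₀ : (Fin r → A K n) →ₗ[A K n] (Fin k → A K n)) : Prop where
  hom : ∀ l, WHom 1 d (d' l) (φ (Pi.single l 1))
  fil : ∀ l, φ (Pi.single l 1) ∈ Fil ω ε (ε' l + 1)
  ini : ∀ l, φ₀ (Pi.single l 1) = wcomp ω ε (ε' l) (φ (Pi.single l 1))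

section Lifts

variable {d' ε' : Fin r → ℕ} {φ φ₀ : (Fin r → A K n) →ₗ[A K n] (Fin k → A K n)}

theorem IsLift.ini_hom (L : IsLift ω d ε d' ε' φ φ₀) (l : Fin r) :
    WHom 1 d (d' l) (φ₀ (Pi.single l 1)) := by
  rw [L.ini]; exact (L.hom l).wcomp

theorem IsLift.ini_whom (L : IsLift ω d ε d' ε' φ φ₀) (l : Fin r) :
    WHom ω ε (ε' l) (φ₀ (Pi.single l 1)) := by
  rw [L.ini]; exact WHom_wcomp

theorem isGradedSub_ker (hφ : ∀ l, WHom 1 d (d' l) (φ (Pi.single l 1))) :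
    IsGradedSub d' (LinearMap.ker φ) := by
  intro c hc a
  rw [homogComp_eq_wcomp, LinearMap.mem_ker, ← wcomp_map hφ, LinearMap.mem_ker.mp hc, map_zero]

/-- Standard representations: elements of `M` of degree `a` can be written in terms of the
generators without exceeding their weight, if the initial parts of the generators generate the
initial module in degree `a`. -/
theorem IsLift.exists_rep (L : IsLift ω d ε d' ε' φ φ₀) (hle : LinearMap.range φ ≤ M)
    (hin : ∀ x ∈ initParts ω d ε M a, x ∈ LinearMap.range φ₀)
    (hf : f ∈ M) (hfa : WHom 1 d a f) (hw : f ∈ Fil ω ε w) :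
    ∃ c ∈ Fil ω ε' w, WHom 1 d' a c ∧ φ c = f := by
  induction w generalizing f with
  | zero =>
    rw [Fil_zero hw]
    exact ⟨0, zero_mem _, fun j u h => by simp at h, map_zero _⟩
  | succ w ih =>
    obtain ⟨c₀, hc₀⟩ := hin _ ⟨w, f, hf, hfa, hw, rfl⟩
    set c := wcomp ω ε' w (wcomp 1 d' a c₀) with hc
    have hcx : φ₀ c = wcomp ω ε w f := by
      rw [hc, ← wcomp_map L.ini_whom, ← wcomp_map L.ini_hom, hc₀, wcomp_comm,
        WHom_wcomp.wcomp_self, wcomp_comm, hfa.wcomp_self]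
    have hcF : c ∈ Fil ω ε' (w + 1) := WHom_wcomp.mem_Fil
    have hca : WHom 1 d' a c := WHom_wcomp.wcomp
    have hcw : WHom ω ε' w c := WHom_wcomp
    obtain ⟨c', hc', hca', hφ'⟩ := ih (f := f - φ c) (sub_mem hf (hle ⟨c, rfl⟩))
      (hfa.sub (hca.map L.hom)) (mem_Fil_of_wcomp_eq_zero
        (sub_mem hw (map_mem_Fil L.fil hcF)) (by
          rw [map_sub, wcomp_map_of_Fil L.fil L.ini hcF, hcw.wcomp_self, hcx, sub_self]))
    refine ⟨c' + c, add_mem (Fil_mono (Nat.le_succ w) hc') hcF, ?_, by rw [map_add, hφ']; simp⟩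
    rw [← hca.wcomp_self, ← hca'.wcomp_self, ← map_add]
    exact WHom_wcomp

theorem IsLift.inMod_ker_le (L : IsLift ω d ε d' ε' φ φ₀) :
    CregPaper.inMod ω ε' (LinearMap.ker φ) ≤ LinearMap.ker φ₀ := by
  intro x hx
  rw [LinearMap.mem_ker, ← Submodule.mem_bot (A K n)]
  refine mem_of_wcomp_mem ω ε fun w => ?_
  obtain ⟨s, hs, hs', hsx⟩ := mem_inMod.mp hx w
  rw [wcomp_map L.ini_whom, ← hsx, ← wcomp_map_of_Fil L.fil L.ini hs', LinearMap.mem_ker.mp hs,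
    map_zero]
  exact zero_mem _

theorem mem_inMod_ker_of_map_eq {y c : Fin r → A K n}
    (hy : WHom ω ε' w y) (hc : c ∈ Fil ω ε' w) (h : φ c = φ y) :
    y ∈ CregPaper.inMod ω ε' (LinearMap.ker φ) := by
  have := wcomp_mem_inMod (M := LinearMap.ker φ) (f := y - c) (ω := ω) (ε := ε') (w := w)
    (by rw [LinearMap.mem_ker, map_sub, h, sub_self])
    (sub_mem hy.mem_Fil (Fil_mono (Nat.le_succ w) hc))
  rwa [map_sub, hy.wcomp_self, wcomp_eq_zero hc, sub_zero] at this

theorem IsLift.map_mem_Fil_of_ker (L : IsLift ω d ε d' ε' φ φ₀) {y : Fin r → A K n}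
    (hy : WHom ω ε' w y) (h : φ₀ y = 0) : φ y ∈ Fil ω ε w := by
  refine mem_Fil_of_wcomp_eq_zero (map_mem_Fil L.fil hy.mem_Fil) ?_
  rw [wcomp_map_of_Fil L.fil L.ini hy.mem_Fil, hy.wcomp_self, h]

theorem IsLift.range_eq (L : IsLift ω d ε d' ε' φ φ₀) (hM : IsGradedSub d M)
    (hle : LinearMap.range φ ≤ M) (hin : CregPaper.inMod ω ε M ≤ LinearMap.range φ₀) :
    LinearMap.range φ = M := by
  refine le_antisymm hle fun f hf => mem_of_wcomp_mem 1 d fun a => ?_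
  obtain ⟨w, hw⟩ := exists_mem_Fil ω ε (wcomp 1 d a f)
  obtain ⟨c, -, -, hc⟩ := L.exists_rep hle (fun x hx => hin (initParts_subset hx).1)
    (hM.wcomp_mem hf a) WHom_wcomp hw
  exact ⟨c, hc⟩

theorem IsLift.inMod_ker (L : IsLift ω d ε d' ε' φ φ₀)
    (hle : LinearMap.range φ ≤ M) (hin : CregPaper.inMod ω ε M ≤ LinearMap.range φ₀) :
    CregPaper.inMod ω ε' (LinearMap.ker φ) = LinearMap.ker φ₀ := by
  refine le_antisymm L.inMod_ker_le fun y hy => ?_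
  refine mem_of_wcomp_mem 1 d' fun a => mem_of_wcomp_mem ω ε' fun w => ?_
  have hya : WHom 1 d' a (wcomp ω ε' w (wcomp 1 d' a y)) := WHom_wcomp.wcomp
  have hyw : WHom ω ε' w (wcomp ω ε' w (wcomp 1 d' a y)) := WHom_wcomp
  have hy0 : φ₀ (wcomp ω ε' w (wcomp 1 d' a y)) = 0 := by
    rw [← wcomp_map L.ini_whom, ← wcomp_map L.ini_hom, LinearMap.mem_ker.mp hy, map_zero, map_zero]
  obtain ⟨c, hc, -, hφc⟩ := L.exists_rep hle (fun x hx => hin (initParts_subset hx).1)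
    (hle ⟨_, rfl⟩) (hya.map L.hom) (L.map_mem_Fil_of_ker hyw hy0)
  exact mem_inMod_ker_of_map_eq hyw hc hφc

/-- If the syzygies of the initial parts lift to syzygies, the initial parts of the generators
generate the initial module. -/
theorem IsLift.inMod_range (L : IsLift ω d ε d' ε' φ φ₀)
    (hker : LinearMap.ker φ₀ ≤ CregPaper.inMod ω ε' (LinearMap.ker φ)) :
    CregPaper.inMod ω ε (LinearMap.range φ) = LinearMap.range φ₀ := by
  apply le_antisymm
  · intro x hx
    refine mem_of_wcomp_mem ω ε fun w => ?_
    obtain ⟨_, ⟨c, rfl⟩, hcw, hcx⟩ := mem_inMod.mp hx w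
    suffices ∃ c' ∈ Fil ω ε' (w + 1), φ c' = φ c by
      obtain ⟨c', hc', hcc⟩ := this
      rw [← hcx, ← hcc, wcomp_map_of_Fil L.fil L.ini hc']
      exact ⟨_, rfl⟩
    clear hcx
    obtain ⟨v, hv⟩ := exists_mem_Fil ω ε' c
    induction v generalizing c with
    | zero => exact ⟨c, Fil_mono (Nat.zero_le _) hv, rfl⟩
    | succ v ih =>
      rcases Nat.lt_or_ge w v with hwv | hwv
      · have h0 : wcomp ω ε' v c ∈ LinearMap.ker φ₀ := by
          rw [LinearMap.mem_ker, ← wcomp_map_of_Fil L.fil L.ini hv]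
          exact wcomp_eq_zero (Fil_mono hwv hcw)
        obtain ⟨s, hs, hsF, hsc⟩ := mem_inMod.mp (hker h0) v
        rw [WHom_wcomp.wcomp_self] at hsc
        have hφ : φ (c - s) = φ c := by rw [map_sub, LinearMap.mem_ker.mp hs, sub_zero]
        have := ih (c - s) (by rwa [hφ]) (mem_Fil_of_wcomp_eq_zero (sub_mem hv hsF)
          (by rw [map_sub, hsc, sub_self]))
        rwa [hφ] at this
      · exact ⟨c, Fil_mono (by omega) hv, rfl⟩
  · rintro _ ⟨c, rfl⟩
    refine mem_of_wcomp_mem ω ε fun w => ?_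
    have hc : WHom ω ε' w (wcomp ω ε' w c) := WHom_wcomp
    have := wcomp_mem_inMod (M := LinearMap.range φ) ⟨_, rfl⟩ (map_mem_Fil L.fil hc.mem_Fil)
    rwa [wcomp_map_of_Fil L.fil L.ini hc.mem_Fil, hc.wcomp_self, ← wcomp_map L.ini_whom] at this

end Lifts

end InitialModules

section Minimality

variable {K : Type*} [Field K] {n k r s t p q : ℕ}

/-- The submodule of the vectors with entries in the homogeneous maximal ideal. -/
noncomputable def maxSub (K : Type*) [Field K] (n r : ℕ) : Submodule (A K n) (Fin r → A K n) :=
  Submodule.pi Set.univ fun _ => mIdeal K n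

theorem mem_maxSub {c : Fin r → A K n} : c ∈ maxSub K n r ↔ ∀ l, c l ∈ mIdeal K n := by
  simp [maxSub, Submodule.mem_pi]

theorem mem_mIdeal {x : A K n} : x ∈ mIdeal K n ↔ x.coeff 0 = 0 := by
  rw [mIdeal, RingHom.mem_ker, MvPolynomial.constantCoeff_eq]

theorem single_notMem_maxSub (l : Fin r) : (Pi.single l 1 : Fin r → A K n) ∉ maxSub K n r := by
  intro h
  have := mem_mIdeal.mp (mem_maxSub.mp h l)
  simp at this

theorem map_mem_maxSub (φ : (Fin p → A K n) →ₗ[A K n] (Fin q → A K n)) {c : Fin p → A K n}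
    (hc : c ∈ maxSub K n p) : φ c ∈ maxSub K n q := by
  rw [eq_sum_smul_single c, map_sum]
  refine sum_mem fun l _ => mem_maxSub.mpr fun i => ?_
  rw [map_smul]
  exact Ideal.mul_mem_right _ _ (mem_maxSub.mp hc l)

/-- Reduction of a vector modulo the maximal ideal. -/
noncomputable def red (c : Fin p → A K n) : Fin p → K := fun l => MvPolynomial.constantCoeff (c l)

theorem mem_maxSub_iff_red {c : Fin p → A K n} : c ∈ maxSub K n p ↔ red c = 0 := by
  rw [mem_maxSub, funext_iff]
  rfl

theorem red_sub (c e : Fin p → A K n) : red (c - e) = red c - red e := by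
  ext l; simp [red]

/-- The vector of constant polynomials with the given entries. -/
noncomputable def constVec (n : ℕ) (v : Fin p → K) : Fin p → A K n := fun l => MvPolynomial.C (v l)

theorem red_constVec (v : Fin p → K) : red (constVec n v) = v := by
  ext l; simp [red, constVec]

/-- Reduction of a linear map modulo the maximal ideal. -/
noncomputable def redMap (φ : (Fin p → A K n) →ₗ[A K n] (Fin q → A K n)) :
    (Fin p → K) →ₗ[K] (Fin q → K) where
  toFun v := red (φ (constVec n v))
  map_add' v w := by
    have : constVec n (v + w) = constVec n v + constVec n w := by ext1 l; simp [constVec]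
    rw [this, map_add]
    ext l; simp [red]
  map_smul' a v := by
    have : constVec n (a • v) = (MvPolynomial.C a : A K n) • constVec n v := by
      ext1 l; simp [constVec]
    rw [this, map_smul]
    ext l; simp [red]

theorem red_map (φ : (Fin p → A K n) →ₗ[A K n] (Fin q → A K n)) (c : Fin p → A K n) :
    red (φ c) = redMap φ (red c) := by
  change red (φ c) = red (φ (constVec n (red c)))
  rw [← sub_eq_zero, ← red_sub, ← map_sub, ← mem_maxSub_iff_red]
  refine map_mem_maxSub φ ?_
  rw [mem_maxSub_iff_red, red_sub, red_constVec, sub_self]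

theorem redMap_eq_zero_iff {φ : (Fin p → A K n) →ₗ[A K n] (Fin q → A K n)} :
    redMap φ = 0 ↔ LinearMap.range φ ≤ maxSub K n q := by
  constructor
  · rintro h _ ⟨c, rfl⟩
    rw [mem_maxSub_iff_red, red_map, h, LinearMap.zero_apply]
  · intro h
    ext1 l
    exact LinearMap.ext fun v => mem_maxSub_iff_red.mp (h ⟨_, rfl⟩)

theorem exists_lift_of_range_le {V : Type*} [AddCommGroup V] [Module (A K n) V]
    {φ : (Fin p → A K n) →ₗ[A K n] V} {ψ : (Fin q → A K n) →ₗ[A K n] V}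
    (h : LinearMap.range φ ≤ LinearMap.range ψ) :
    ∃ α : (Fin p → A K n) →ₗ[A K n] (Fin q → A K n), ∀ c, ψ (α c) = φ c := by
  choose b hb using fun l : Fin p => h ⟨Pi.single l 1, rfl⟩
  refine ⟨Fintype.linearCombination (A K n) b, fun c => ?_⟩
  rw [Fintype.linearCombination_apply, map_sum]
  conv_rhs => rw [eq_sum_smul_single c, map_sum]
  exact Finset.sum_congr rfl fun l _ => by rw [map_smul, hb, map_smul]

theorem le_of_injective_redMap {α : (Fin p → A K n) →ₗ[A K n] (Fin q → A K n)}
    (h : Function.Injective (redMap α)) : p ≤ q := by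
  simpa using LinearMap.finrank_le_finrank_of_injective h

/-- A minimal system of generators has the least possible number of elements. -/
theorem le_of_ker_le_maxSub {φ : (Fin p → A K n) →ₗ[A K n] (Fin k → A K n)}
    {ψ : (Fin q → A K n) →ₗ[A K n] (Fin k → A K n)}
    (h : LinearMap.range φ = LinearMap.range ψ) (hφ : LinearMap.ker φ ≤ maxSub K n p) :
    p ≤ q := by
  obtain ⟨α, hα⟩ := exists_lift_of_range_le h.le
  obtain ⟨β, hβ⟩ := exists_lift_of_range_le h.ge
  refine le_of_injective_redMap (α := α) (Function.LeftInverse.injective (g := redMap β) ?_)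
  intro v
  rw [← red_constVec (n := n) v, ← red_map, ← red_map, ← sub_eq_zero, ← red_sub,
    ← mem_maxSub_iff_red]
  refine hφ ?_
  rw [LinearMap.mem_ker, map_sub, hβ, hα, sub_self]

/-- Comparison of a minimal presentation `A^t' → A^r'` with an arbitrary presentation
`A^t → A^r` of the same module. -/
theorem add_finrank_range_redMap_le {r' t' : ℕ}
    {φ : (Fin r → A K n) →ₗ[A K n] (Fin k → A K n)} {D : (Fin t → A K n) →ₗ[A K n] (Fin r → A K n)}
    {φ' : (Fin r' → A K n) →ₗ[A K n] (Fin k → A K n)}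
    {D' : (Fin t' → A K n) →ₗ[A K n] (Fin r' → A K n)}
    (hφ : LinearMap.range φ = LinearMap.range φ')
    (hD : LinearMap.range D = LinearMap.ker φ) (hD' : LinearMap.range D' = LinearMap.ker φ')
    (hm : LinearMap.range D' ≤ maxSub K n r') (hm' : LinearMap.ker D' ≤ maxSub K n t') :
    t' + Module.finrank K (LinearMap.range (redMap D)) ≤ t := by
  have hDφ : ∀ x, φ (D x) = 0 := fun x => LinearMap.mem_ker.mp (hD ▸ ⟨x, rfl⟩)
  have hDφ' : ∀ x, φ' (D' x) = 0 := fun x => LinearMap.mem_ker.mp (hD' ▸ ⟨x, rfl⟩)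
  obtain ⟨α, hα⟩ := exists_lift_of_range_le hφ.ge
  obtain ⟨β, hβ⟩ := exists_lift_of_range_le hφ.le
  obtain ⟨α₁, hα₁⟩ := exists_lift_of_range_le (φ := α ∘ₗ D') (ψ := D) (by
    rw [hD]
    rintro _ ⟨x, rfl⟩
    rw [LinearMap.mem_ker, LinearMap.comp_apply, hα, hDφ'])
  obtain ⟨β₁, hβ₁⟩ := exists_lift_of_range_le (φ := β ∘ₗ D) (ψ := D') (by
    rw [hD']
    rintro _ ⟨x, rfl⟩
    rw [LinearMap.mem_ker, LinearMap.comp_apply, hβ, hDφ])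
  obtain ⟨σ, hσ⟩ := exists_lift_of_range_le (φ := β ∘ₗ α - LinearMap.id) (ψ := D') (by
    rw [hD']
    rintro _ ⟨x, rfl⟩
    rw [LinearMap.mem_ker, LinearMap.sub_apply, map_sub, LinearMap.comp_apply, hβ, hα]
    simp)
  have hred : ∀ v, redMap β₁ (redMap α₁ v) = v := by
    intro v
    rw [← red_constVec (n := n) v, ← red_map, ← red_map, ← sub_eq_zero, ← red_sub,
      ← mem_maxSub_iff_red]
    set x := constVec n v
    have h1 : β₁ (α₁ x) - x - σ (D' x) ∈ maxSub K n t' := by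
      refine hm' ?_
      rw [LinearMap.mem_ker, map_sub, map_sub, hβ₁, hσ, LinearMap.comp_apply, hα₁]
      simp
    have h2 := add_mem h1 (map_mem_maxSub σ (hm ⟨x, rfl⟩))
    simpa using h2
  have hker : LinearMap.range (redMap α₁) ≤ LinearMap.ker (redMap D) := by
    rintro _ ⟨v, rfl⟩
    rw [LinearMap.mem_ker, ← red_constVec (n := n) v, ← red_map, ← red_map, hα₁,
      ← mem_maxSub_iff_red]
    exact map_mem_maxSub α (hm ⟨_, rfl⟩)
  have hinj : Function.Injective (redMap α₁) := Function.LeftInverse.injective hred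
  have h1 := LinearMap.finrank_range_add_finrank_ker (redMap D)
  have h2 := LinearMap.finrank_range_of_inj hinj
  have h3 := Submodule.finrank_mono hker
  simp only [Module.finrank_fin_fun] at h1 h2
  omega

/-- A submodule spanned by a set `X` of homogeneous elements has a minimal system of generators
contained in `X`. -/
theorem exists_minimal_generators (d : Fin k → ℕ) (X : Set (Fin k → A K n))
    (hX : ∀ x ∈ X, ∃ a, WHom 1 d a x) :
    ∃ (r : ℕ) (h : Fin r → Fin k → A K n), (∀ l, h l ∈ X) ∧
      LinearMap.range (Fintype.linearCombination (A K n) h) = Submodule.span (A K n) X ∧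
      LinearMap.ker (Fintype.linearCombination (A K n) h) ≤ maxSub K n r := by
  classical
  have hex : ∃ r : ℕ, ∃ h : Fin r → Fin k → A K n, (∀ l, h l ∈ X) ∧
      Submodule.span (A K n) (Set.range h) = Submodule.span (A K n) X := by
    obtain ⟨s, hs, hsX⟩ := Submodule.fg_span_iff_fg_span_finset_subset X |>.mp
      (IsNoetherian.noetherian (Submodule.span (A K n) X))
    refine ⟨s.card, fun i => (s.equivFin.symm i : Fin k → A K n), fun l => hs (by simp), ?_⟩
    rw [hsX]
    congr 1
    ext x
    constructor
    · rintro ⟨i, rfl⟩; simp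
    · intro hx; exact ⟨s.equivFin ⟨x, hx⟩, by simp⟩
  obtain ⟨h, hhX, hspan⟩ := Nat.find_spec hex
  refine ⟨Nat.find hex, h, hhX, by rw [Fintype.range_linearCombination, hspan], ?_⟩
  have hmin : ∀ m < Nat.find hex, _ := fun m hm => Nat.find_min hex hm
  generalize Nat.find hex = r at *
  choose d' hd' using fun l => hX _ (hhX l)
  set φ := Fintype.linearCombination (A K n) h with hφdef
  have hφ : ∀ l, φ (Pi.single l 1) = h l := fun l => by
    rw [hφdef, Fintype.linearCombination_apply_single, one_smul]
  intro c hc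
  by_contra hcm
  rw [mem_maxSub] at hcm
  push Not at hcm
  obtain ⟨i, hi⟩ := hcm
  rw [mem_mIdeal] at hi
  have hc' : φ (wcomp 1 d' (d' i) c) = 0 := by
    rw [← wcomp_map (fun l => by rw [hφ]; exact hd' l), LinearMap.mem_ker.mp hc, map_zero]
  have hci : wcomp 1 d' (d' i) c i = MvPolynomial.C ((c i).coeff 0) := by
    ext u
    rw [coeff_wcomp, MvPolynomial.coeff_C]
    by_cases hu : u = 0
    · simp [hu]
    · rw [if_neg, if_neg (Ne.symm hu)]
      intro h0
      exact hu (eq_zero_of_wdeg_one (by omega))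
  generalize wcomp 1 d' (d' i) c = e at hc' hci
  obtain _ | m := r
  · exact i.elim0
  refine hmin m (Nat.lt_succ_self m) ⟨h ∘ i.succAbove, fun l => hhX _, ?_⟩
  rw [← hspan]
  apply le_antisymm
  · exact Submodule.span_mono (Set.range_comp_subset_range _ _)
  · refine Submodule.span_le.mpr ?_
    rintro _ ⟨l, rfl⟩
    by_cases hl : l = i
    · subst hl
      rw [hφdef, Fintype.linearCombination_apply, Fin.sum_univ_succAbove _ l, hci] at hc'
      have h1 : h l = (MvPolynomial.C ((c l).coeff 0)⁻¹ : A K n) •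
          (MvPolynomial.C ((c l).coeff 0) : A K n) • h l := by
        rw [smul_smul, ← map_mul, inv_mul_cancel₀ hi, map_one, one_smul]
      rw [h1, eq_neg_of_add_eq_zero_left hc']
      refine Submodule.smul_mem _ _ (neg_mem (sum_mem fun j _ => Submodule.smul_mem _ _ ?_))
      exact Submodule.subset_span ⟨j, rfl⟩
    · obtain ⟨j, rfl⟩ := Fin.exists_succAbove_eq hl
      exact Submodule.subset_span ⟨j, rfl⟩

end Minimality

section Resolutions

variable {K : Type*} [Field K] {n k r p q : ℕ} {ω : Fin n → ℕ} {d ε : Fin k → ℕ}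
  {M N : Submodule (A K n) (Fin k → A K n)} {a : ℕ}

theorem range_le_of_single {φ : (Fin p → A K n) →ₗ[A K n] (Fin k → A K n)}
    (h : ∀ l, φ (Pi.single l 1) ∈ N) : LinearMap.range φ ≤ N := by
  rintro _ ⟨c, rfl⟩
  rw [eq_sum_smul_single c, map_sum]
  exact sum_mem fun l _ => by rw [map_smul]; exact N.smul_mem _ (h l)

theorem linearCombination_single (h : Fin p → Fin k → A K n) (l : Fin p) :
    Fintype.linearCombination (A K n) h (Pi.single l 1) = h l := by
  rw [Fintype.linearCombination_apply_single, one_smul]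

theorem WHom.mem_maxSub_of_lt {d' : Fin p → ℕ} {c : Fin p → A K n} (hc : WHom 1 d' a c)
    (h : ∀ l, d' l < a) : c ∈ maxSub K n p := by
  refine mem_maxSub.mpr fun l => mem_mIdeal.mpr ?_
  by_contra h0
  have h1 := hc l 0 h0
  have h2 := h l
  rw [wdeg_zero] at h1
  omega

theorem WHom.eq_zero_of_mem_maxSub {d' : Fin p → ℕ} {c : Fin p → A K n} (hc : WHom 1 d' a c)
    (h : ∀ l, d' l = a) (hm : c ∈ maxSub K n p) : c = 0 := by
  ext l u
  by_contra hu
  have h1 := hc l u hu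
  have h2 := h l
  obtain rfl := eq_zero_of_wdeg_one (u := u) (by omega)
  exact hu (mem_mIdeal.mp (mem_maxSub.mp hm l))

theorem GFRes.Minimal.range_diff_le {res : GFRes d M} (h : res.Minimal) (i : ℕ) :
    LinearMap.range (res.diff i) ≤ maxSub K n (res.rk i) := by
  rintro _ ⟨x, rfl⟩
  exact mem_maxSub.mpr (h i x)

theorem GFRes.Minimal.ker_aug_le {res : GFRes d M} (h : res.Minimal) :
    LinearMap.ker res.aug ≤ maxSub K n (res.rk 0) :=
  res.ex0 ▸ h.range_diff_le 0

theorem GFRes.Minimal.ker_diff_le {res : GFRes d M} (h : res.Minimal) (i : ℕ) :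
    LinearMap.ker (res.diff i) ≤ maxSub K n (res.rk (i + 1)) :=
  res.exs i ▸ h.range_diff_le (i + 1)

/-- Coinductive construction of minimal graded free resolutions. -/
theorem exists_minimal_gfres (C : ℕ → ℕ → Prop)
    (Q : ℕ → (k : ℕ) → (Fin k → ℕ) → Submodule (A K n) (Fin k → A K n) → Prop)
    (step : ∀ i k (d : Fin k → ℕ) (N : Submodule (A K n) (Fin k → A K n)), Q i k d N →
      ∃ (r : ℕ) (d' : Fin r → ℕ) (φ : (Fin r → A K n) →ₗ[A K n] (Fin k → A K n)),
        LinearMap.range φ = N ∧ (∀ l, WHom 1 d (d' l) (φ (Pi.single l 1))) ∧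
        LinearMap.ker φ ≤ maxSub K n r ∧ (∀ l, C i (d' l)) ∧ Q (i + 1) r d' (LinearMap.ker φ))
    (h : Q 0 k d N) : ∃ res : GFRes d N, res.Minimal ∧ ∀ i l, C i (res.sh i l) := by
  choose r d' φ h1 h2 h3 h4 h5 using step
  let st : ∀ i, Σ' (k : ℕ) (d : Fin k → ℕ) (N : Submodule (A K n) (Fin k → A K n)), Q i k d N :=
    fun i => Nat.rec ⟨k, d, N, h⟩
      (fun i s => ⟨r i _ _ _ s.2.2.2, d' i _ _ _ s.2.2.2, LinearMap.ker (φ i _ _ _ s.2.2.2),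
        h5 i _ _ _ s.2.2.2⟩) i
  refine ⟨{ rk := fun i => (st (i + 1)).1
            sh := fun i => (st (i + 1)).2.1
            aug := φ 0 _ _ _ (st 0).2.2.2
            diff := fun i => φ (i + 1) _ _ _ (st (i + 1)).2.2.2
            aug_range := h1 0 _ _ _ (st 0).2.2.2
            aug_hom := fun l => isHomog_iff.mpr (h2 0 _ _ _ (st 0).2.2.2 l)
            diff_hom := fun i l => isHomog_iff.mpr (h2 (i + 1) _ _ _ (st (i + 1)).2.2.2 l)
            ex0 := h1 1 _ _ _ (st 1).2.2.2
            exs := fun i => h1 (i + 2) _ _ _ (st (i + 2)).2.2.2 }, ?_, ?_⟩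
  · intro i x
    refine mem_maxSub.mp (h3 i _ _ _ (st i).2.2.2 ?_)
    have := h1 (i + 1) _ _ _ (st (i + 1)).2.2.2
    exact this.le ⟨x, rfl⟩
  · exact fun i l => h4 i _ _ _ (st i).2.2.2 l

theorem IsGradedSub.exists_minimal_gfres (hN : IsGradedSub d N) :
    ∃ res : GFRes d N, res.Minimal := by
  refine (CregPaper.exists_minimal_gfres (fun _ _ => True) (fun _ _ d N => IsGradedSub d N)
    (fun i k d N hN => ?_) hN).imp fun res h => h.1
  obtain ⟨r, h, hX, hr, hk⟩ := exists_minimal_generators d {x | x ∈ N ∧ ∃ a, WHom 1 d a x}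
    fun x hx => hx.2
  choose hN' d' hd' using hX
  have hom : ∀ l, WHom 1 d (d' l) (Fintype.linearCombination (A K n) h (Pi.single l 1)) :=
    fun l => by rw [linearCombination_single]; exact hd' l
  refine ⟨r, d', _, ?_, hom, hk, fun _ => trivial, isGradedSub_ker hom⟩
  rw [hr]
  apply le_antisymm
  · exact Submodule.span_le.mpr fun x hx => hx.1
  · exact fun x hx => mem_of_wcomp_mem 1 d fun a =>
      Submodule.subset_span ⟨hN.wcomp_mem hx a, a, WHom_wcomp⟩

/-- `N` has an `a`-linear graded free resolution. -/
def LinRes (d : Fin k → ℕ) (N : Submodule (A K n) (Fin k → A K n)) (a : ℕ) : Prop :=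
  ∃ res : GFRes d N, ∀ i l, res.sh i l = i + a

theorem GFRes.minimal_of_linear {res : GFRes d N} (h : ∀ i l, res.sh i l = i + a) :
    res.Minimal := by
  intro i x
  refine mem_maxSub.mp ?_
  refine range_le_of_single (φ := res.diff i) (fun l => ?_) ⟨x, rfl⟩
  refine (isHomog_iff.mp (res.diff_hom i l)).mem_maxSub_of_lt fun j => ?_
  rw [h, h]
  omega

theorem exists_graded_lift {dp : Fin p → ℕ} {dq : Fin q → ℕ}
    {φ : (Fin p → A K n) →ₗ[A K n] (Fin k → A K n)} {ψ : (Fin q → A K n) →ₗ[A K n] (Fin k → A K n)}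
    (hφ : ∀ l, WHom 1 d (dp l) (φ (Pi.single l 1)))
    (hψ : ∀ l, WHom 1 d (dq l) (ψ (Pi.single l 1)))
    (h : LinearMap.range φ ≤ LinearMap.range ψ) :
    ∃ α : (Fin p → A K n) →ₗ[A K n] (Fin q → A K n), (∀ c, ψ (α c) = φ c) ∧
      ∀ l, WHom 1 dq (dp l) (α (Pi.single l 1)) := by
  obtain ⟨α, hα⟩ := exists_lift_of_range_le h
  refine ⟨Fintype.linearCombination (A K n) fun l => wcomp 1 dq (dp l) (α (Pi.single l 1)),
    fun c => ?_, fun l => ?_⟩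
  · rw [eq_sum_smul_single c]
    simp only [map_sum, map_smul, linearCombination_single]
    refine Finset.sum_congr rfl fun l _ => ?_
    rw [← wcomp_map hψ, hα, (hφ l).wcomp_self]
  · rw [linearCombination_single]
    exact WHom_wcomp

theorem eq_id_of_graded {dp : Fin p → ℕ} (hd : ∀ l, dp l = a)
    {φ : (Fin p → A K n) →ₗ[A K n] (Fin k → A K n)} (hk : LinearMap.ker φ ≤ maxSub K n p)
    {α : (Fin p → A K n) →ₗ[A K n] (Fin p → A K n)}
    (hα : ∀ l, WHom 1 dp (dp l) (α (Pi.single l 1))) (h : ∀ c, φ (α c) = φ c)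
    (c : Fin p → A K n) : α c = c := by
  have key : ∀ l, α (Pi.single l 1) = Pi.single l 1 := by
    intro l
    have h1 : WHom 1 dp (dp l) (Pi.single l 1 : Fin p → A K n) := by
      have := WHom_single (K := K) (ω := (1 : Fin n → ℕ)) (η := dp) l 0
      rwa [wdeg_zero, zero_add] at this
    rw [← sub_eq_zero]
    refine ((hα l).sub h1).eq_zero_of_mem_maxSub (fun j => by rw [hd, hd]) (hk ?_)
    rw [LinearMap.mem_ker, map_sub, h, sub_self]
  rw [eq_sum_smul_single c]
  simp only [map_sum, map_smul, key]

/-- The syzygies of any minimal system of generators of a module with an `a`-linear resolution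
have an `(a + 1)`-linear resolution. -/
theorem LinRes.ker (hN : LinRes d N a) {dp : Fin p → ℕ} (hd : ∀ l, dp l = a)
    {φ : (Fin p → A K n) →ₗ[A K n] (Fin k → A K n)}
    (hφ : ∀ l, WHom 1 d (dp l) (φ (Pi.single l 1)))
    (hr : LinearMap.range φ = N) (hk : LinearMap.ker φ ≤ maxSub K n p) :
    LinRes dp (LinearMap.ker φ) (a + 1) := by
  obtain ⟨res, hres⟩ := hN
  have hmin := GFRes.minimal_of_linear hres
  have haug := fun l => isHomog_iff.mp (res.aug_hom l)
  have hd0 : ∀ l, res.sh 0 l = a := fun l => by rw [hres, zero_add]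
  obtain ⟨α, hα, hα'⟩ := exists_graded_lift hφ haug (by rw [hr, res.aug_range])
  obtain ⟨β, hβ, hβ'⟩ := exists_graded_lift haug hφ (by rw [hr, res.aug_range])
  have hβα : ∀ c, β (α c) = c := eq_id_of_graded (α := β ∘ₗ α) hd hk
    (fun l => WHom.map (φ := β) hβ' (hα' l)) fun c => by rw [LinearMap.comp_apply, hβ, hα]
  have hαβ : ∀ c, α (β c) = c := eq_id_of_graded (α := α ∘ₗ β) hd0 hmin.ker_aug_le
    (fun l => WHom.map (φ := α) hα' (hβ' l)) fun c => by rw [LinearMap.comp_apply, hα, hβ]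
  refine ⟨{ rk := fun i => res.rk (i + 1)
            sh := fun i => res.sh (i + 1)
            aug := β ∘ₗ res.diff 0
            diff := fun i => res.diff (i + 1)
            aug_range := ?_
            aug_hom := fun l => isHomog_iff.mpr
              (WHom.map (φ := β) hβ' (isHomog_iff.mp (res.diff_hom 0 l)))
            diff_hom := fun i l => res.diff_hom (i + 1) l
            ex0 := ?_
            exs := fun i => res.exs (i + 1) }, fun i l => by rw [hres]; omega⟩
  · ext c
    constructor
    · rintro ⟨x, rfl⟩
      rw [LinearMap.mem_ker, LinearMap.comp_apply, hβ]
      exact LinearMap.mem_ker.mp (res.ex0.le ⟨x, rfl⟩)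
    · intro hc
      obtain ⟨x, hx⟩ := res.ex0.ge (x := α c) (by
        rw [LinearMap.mem_ker, hα, LinearMap.mem_ker.mp hc])
      exact ⟨x, by rw [LinearMap.comp_apply, hx, hβα]⟩
  · rw [res.exs 0]
    ext c
    rw [LinearMap.mem_ker, LinearMap.mem_ker, LinearMap.comp_apply]
    constructor
    · intro h; rw [h, map_zero]
    · intro h; rw [← hαβ (res.diff 0 c), h, map_zero]

theorem exists_coeff_ne_zero {c : Fin p → A K n} (hc : c ≠ 0) : ∃ l u, (c l).coeff u ≠ 0 := by
  by_contra! h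
  exact hc (by ext l u; rw [h]; rfl)

/-- A module generated in degree `a` of regularity at most `a` has an `a`-linear resolution. -/
theorem RegLE.linRes (h : RegLE d N a) {dp : Fin p → ℕ} (hd : ∀ l, dp l = a)
    {φ : (Fin p → A K n) →ₗ[A K n] (Fin k → A K n)}
    (hφ : ∀ l, WHom 1 d (dp l) (φ (Pi.single l 1)))
    (hr : LinearMap.range φ = N) : LinRes d N a := by
  obtain ⟨res, hmin, hle⟩ := h
  refine ⟨res, fun i l => le_antisymm (hle i l) ?_⟩
  induction i with
  | zero =>
    obtain ⟨α, hα, hα'⟩ := exists_graded_lift (fun l => isHomog_iff.mp (res.aug_hom l)) hφ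
      (by rw [hr, res.aug_range])
    have h0 : α (Pi.single l 1) ≠ 0 := by
      intro h0
      refine single_notMem_maxSub l (hmin.ker_aug_le ?_)
      rw [LinearMap.mem_ker, ← hα, h0, map_zero]
    obtain ⟨j, u, hu⟩ := exists_coeff_ne_zero h0
    have h1 := hα' l j u hu
    have h2 := hd j
    omega
  | succ i ih =>
    have h0 : res.diff i (Pi.single l 1) ≠ 0 := fun h0 =>
      single_notMem_maxSub l (hmin.ker_diff_le i (LinearMap.mem_ker.mpr h0))
    obtain ⟨j, u, hu⟩ := exists_coeff_ne_zero h0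
    have h1 := isHomog_iff.mp (res.diff_hom i l) j u hu
    have h2 := ih j
    have h3 : wdeg 1 u ≠ 0 := by
      intro h3
      rw [eq_zero_of_wdeg_one h3] at hu
      exact hu (mem_mIdeal.mp (hmin i _ j))
    omega

theorem LinRes.le_compSub (h : LinRes d N a) : N ≤ compSub d N a := by
  obtain ⟨res, hres⟩ := h
  conv_lhs => rw [← res.aug_range]
  refine range_le_of_single fun l => Submodule.subset_span ⟨res.aug_range.le ⟨_, rfl⟩, ?_⟩
  have := res.aug_hom l
  rwa [hres, zero_add] at this

/-- Generators of (the part of degree in `S` of) the initial module are initial parts of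
homogeneous elements. -/
theorem exists_isLift (ω : Fin n → ℕ) (d ε : Fin k → ℕ)
    (M : Submodule (A K n) (Fin k → A K n)) (S : Set ℕ) :
    ∃ (r : ℕ) (d' ε' : Fin r → ℕ) (φ φ₀ : (Fin r → A K n) →ₗ[A K n] (Fin k → A K n)),
      IsLift ω d ε d' ε' φ φ₀ ∧ (∀ l, d' l ∈ S) ∧ LinearMap.range φ ≤ M ∧
      LinearMap.range φ₀ = Submodule.span (A K n) (⋃ a ∈ S, initParts ω d ε M a) ∧
      LinearMap.ker φ₀ ≤ maxSub K n r := by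
  obtain ⟨r, h, hX, hr, hk⟩ := exists_minimal_generators d (⋃ a ∈ S, initParts ω d ε M a) (by
    intro x hx
    simp only [Set.mem_iUnion] at hx
    obtain ⟨a, -, ha⟩ := hx
    exact ⟨a, (initParts_subset ha).2⟩)
  simp only [Set.mem_iUnion] at hX
  choose d' hdS ε' f hfM hfa hfw hfx using hX
  refine ⟨r, d', ε', Fintype.linearCombination (A K n) f, Fintype.linearCombination (A K n) h,
    ⟨?_, ?_, ?_⟩, hdS, range_le_of_single ?_, hr, hk⟩
  all_goals intro l
  all_goals simp only [linearCombination_single]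
  exacts [hfa l, hfw l, hfx l, hfM l]

theorem le_maxSub_of_inMod_le {N : Submodule (A K n) (Fin p → A K n)} {dp ε : Fin p → ℕ}
    (hd : ∀ l, dp l = a) (hN : IsGradedSub dp N) (h : inMod ω ε N ≤ maxSub K n p) :
    N ≤ maxSub K n p := by
  intro c hc
  have key : ∀ v, ∀ e ∈ N, WHom 1 dp a e → e ∈ Fil ω ε v → e = 0 := by
    intro v
    induction v with
    | zero => exact fun e _ _ he => Fil_zero he
    | succ v ih =>
      intro e heN hea he
      refine ih e heN hea (mem_Fil_of_wcomp_eq_zero he ?_)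
      exact hea.wcomp.eq_zero_of_mem_maxSub hd (h (wcomp_mem_inMod heN he))
  obtain ⟨v, hv⟩ := exists_mem_Fil ω ε (wcomp 1 dp a c)
  have h0 := key v _ (hN.wcomp_mem hc a) WHom_wcomp hv
  refine mem_maxSub.mpr fun l => mem_mIdeal.mpr ?_
  have := coeff_wcomp 1 dp a c l 0
  rw [wdeg_zero, zero_add, if_pos (hd l), h0] at this
  simpa using this.symm

/-- If the initial module of `N` has an `a`-linear resolution, then so does `N`. -/
theorem LinRes.of_inMod (hN : IsGradedSub d N) (h : LinRes d (inMod ω ε N) a) : RegLE d N a := by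
  refine (exists_minimal_gfres (fun i s => s = i + a)
    (fun i _ d N => IsGradedSub d N ∧ ∃ ε, LinRes d (inMod ω ε N) (i + a))
    (fun i k d N ⟨hN, ε, h⟩ => ?_) ⟨hN, ε, by rwa [zero_add]⟩).imp
      fun res h => ⟨h.1, fun i l => (h.2 i l).le⟩
  obtain ⟨r, d', ε', φ, φ₀, L, hd', hle, hr, hk⟩ := exists_isLift ω d ε N {i + a}
  have hin : LinearMap.range φ₀ = inMod ω ε N := by
    rw [hr, Set.biUnion_singleton, ← compSub_inMod hN]
    exact le_antisymm (Submodule.span_le.mpr fun x hx => hx.1) h.le_compSub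
  have hker := L.inMod_ker hle hin.ge
  have hgr := isGradedSub_ker L.hom
  refine ⟨r, d', φ, L.range_eq hN hle hin.ge, L.hom, ?_, hd', hgr, ε', ?_⟩
  · exact le_maxSub_of_inMod_le (ω := ω) (ε := ε') hd' hgr (hker ▸ hk)
  · rw [hker, show i + 1 + a = i + a + 1 by omega]
    exact h.ker hd' L.ini_hom hin hk

end Resolutions

section Main

variable {K : Type*} [Field K] {n k r p q : ℕ} {ω : Fin n → ℕ} {d ε : Fin k → ℕ}
  {M N : Submodule (A K n) (Fin k → A K n)} {a : ℕ}

theorem GFRes.Minimal.rk_zero_eq {res : GFRes d M} (h : res.Minimal)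
    {ψ : (Fin r → A K n) →ₗ[A K n] (Fin k → A K n)} (hr : LinearMap.range ψ = M)
    (hk : LinearMap.ker ψ ≤ maxSub K n r) : res.rk 0 = r :=
  le_antisymm (le_of_ker_le_maxSub (res.aug_range.trans hr.symm) h.ker_aug_le)
    (le_of_ker_le_maxSub (hr.trans res.aug_range.symm) hk)

/-- If the first Betti numbers of `M` and its initial module agree, then elements of `M` lifting
minimal generators of the initial module are minimal generators of `M`. -/
theorem IsLift.ker_le_maxSub {d' ε' : Fin r → ℕ}
    {ψ ψ₀ : (Fin r → A K n) →ₗ[A K n] (Fin k → A K n)} (L : IsLift ω d ε d' ε' ψ ψ₀)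
    (hψ : LinearMap.range ψ = M) (hψ₀ : LinearMap.range ψ₀ = inMod ω ε M)
    (hker : LinearMap.ker ψ₀ ≤ maxSub K n r) {res1 : GFRes d M} {res2 : GFRes d (inMod ω ε M)}
    (h1 : res1.Minimal) (hrk : res1.rk 1 = res2.rk 1) :
    LinearMap.ker ψ ≤ maxSub K n r := by
  have hgr := isGradedSub_ker L.hom
  have hin := L.inMod_ker hψ.le hψ₀.ge
  obtain ⟨t, e, η, D, D₀, L', -, hle, hr, hk⟩ := exists_isLift ω d' ε' (LinearMap.ker ψ) Set.univ
  rw [Set.biUnion_univ, span_iUnion_initParts hgr, hin] at hr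
  have hD := L'.range_eq hgr hle (hin.trans hr.symm).le
  have ht := add_finrank_range_redMap_le (φ := res2.aug) (D := res2.diff 0)
    (res2.aug_range.trans hψ₀.symm) res2.ex0 hr (hr ▸ hker) hk
  have ht' := add_finrank_range_redMap_le (φ' := res1.aug) (D' := res1.diff 0)
    (hψ.trans res1.aug_range.symm) hD res1.ex0 (h1.range_diff_le 0) (h1.ker_diff_le 0)
  have h0 : Module.finrank K (LinearMap.range (redMap D)) = 0 := by
    simp only [zero_add] at ht ht'
    omega
  rw [← hD, ← redMap_eq_zero_iff]
  exact LinearMap.range_eq_bot.mp (Submodule.finrank_eq_zero.mp h0)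

theorem compSub_eq_bot (h : compSub d (inMod ω ε M) a = ⊥) :
    compSub d M a = ⊥ := by
  refine Submodule.span_eq_bot.mpr fun f hf => ?_
  obtain ⟨hfM, hfa⟩ := hf
  rw [isHomog_iff] at hfa
  obtain ⟨w, hw⟩ := exists_mem_Fil ω ε f
  induction w with
  | zero => exact Fil_zero hw
  | succ w ih =>
    refine ih (mem_Fil_of_wcomp_eq_zero hw ?_)
    rw [← Submodule.mem_bot (A K n), ← h]
    exact Submodule.subset_span ⟨wcomp_mem_inMod hfM hw, isHomog_iff.mpr hfa.wcomp⟩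

theorem exists_eq_single_add {u : Fin n →₀ ℕ} (h : u ≠ 0) :
    ∃ i u', u = Finsupp.single i 1 + u' := by
  obtain ⟨i, hi⟩ := Finsupp.ne_iff.mp h
  exact ⟨i, u - Finsupp.single i 1, (add_tsub_cancel_of_le (Finsupp.single_le_iff.mpr
    (Nat.one_le_iff_ne_zero.mpr hi))).symm⟩

theorem WHom.monomial_smul {f : Fin k → A K n} {w : ℕ} (hf : WHom ω ε w f) (u : Fin n →₀ ℕ)
    (c : K) : WHom ω ε (wdeg ω u + w) (MvPolynomial.monomial u c • f) := by
  rw [← hf.wcomp_self, ← wcomp_monomial_smul]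
  exact WHom_wcomp

theorem eq_sum_monomial_smul (c : Fin p → A K n) :
    c = ∑ l, ∑ u ∈ (c l).support,
      MvPolynomial.monomial u ((c l).coeff u) • Pi.single l (1 : A K n) := by
  conv_lhs => rw [eq_sum_smul_single c]
  refine Finset.sum_congr rfl fun l _ => ?_
  rw [← Finset.sum_smul, ← MvPolynomial.as_sum]

/-- An element of `M` of degree `a + 1` given by a combination of generators with coefficients
without constant terms is generated by elements of `M` of degree `a`, without exceeding its
weight. -/
theorem IsLift.exists_rep_succ {d' ε' : Fin r → ℕ}
    {ψ ψ₀ : (Fin r → A K n) →ₗ[A K n] (Fin k → A K n)} (L : IsLift ω d ε d' ε' ψ ψ₀)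
    (hψ : LinearMap.range ψ = M) {d'' ε'' : Fin p → ℕ}
    {φ φ₀ : (Fin p → A K n) →ₗ[A K n] (Fin k → A K n)} (L' : IsLift ω d ε d'' ε'' φ φ₀)
    (hle : LinearMap.range φ ≤ M) (hin : ∀ x ∈ initParts ω d ε M a, x ∈ LinearMap.range φ₀)
    {w : ℕ} {c : Fin r → A K n} (hca : WHom 1 d' (a + 1) c) (hcw : c ∈ Fil ω ε' w)
    (hcm : c ∈ maxSub K n r) : ∃ e ∈ Fil ω ε'' w, φ e = ψ c := by
  suffices ψ c ∈ (Fil (K := K) ω ε'' w).map (φ.restrictScalars K) from this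
  rw [eq_sum_monomial_smul c]
  simp only [map_sum, map_smul]
  refine sum_mem fun l _ => sum_mem fun u hu => ?_
  rw [MvPolynomial.mem_support_iff] at hu
  have hu0 : u ≠ 0 := by
    rintro rfl
    exact hu (mem_mIdeal.mp (mem_maxSub.mp hcm l))
  have hua := hca l u hu
  have huw := hcw l u hu
  obtain ⟨i, u', rfl⟩ := exists_eq_single_add hu0
  have hi : wdeg 1 (Finsupp.single i 1) = 1 := by simp [wdeg]
  rw [wdeg_add, hi] at hua
  rw [wdeg_add] at huw
  set β := (c l).coeff (Finsupp.single i 1 + u')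
  have hfa := (L.hom l).monomial_smul u' β
  rw [show wdeg 1 u' + d' l = a by omega] at hfa
  obtain ⟨e, he, -, hee⟩ := L'.exists_rep hle hin
    (M.smul_mem (MvPolynomial.monomial u' β) (hψ.le ⟨Pi.single l 1, rfl⟩)) hfa
    (monomial_smul_mem_Fil (L.fil l))
  refine ⟨MvPolynomial.monomial (Finsupp.single i 1) (1 : K) • e,
    Fil_mono (by omega) (monomial_smul_mem_Fil he), ?_⟩
  rw [LinearMap.restrictScalars_apply, map_smul, hee, smul_smul, MvPolynomial.monomial_mul,
    one_mul]

theorem regLE_compSub {d' ε' : Fin r → ℕ}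
    {ψ ψ₀ : (Fin r → A K n) →ₗ[A K n] (Fin k → A K n)} (hM : IsGradedSub d M)
    (L : IsLift ω d ε d' ε' ψ ψ₀) (hψ : LinearMap.range ψ = M)
    (hψ₀ : LinearMap.range ψ₀ = inMod ω ε M) (hker : LinearMap.ker ψ ≤ maxSub K n r)
    (h : RegLE d (compSub d (inMod ω ε M) a) a) : RegLE d (compSub d M a) a := by
  obtain ⟨p, d'', ε'', φ, φ₀, L', hd, hle, hr, hk⟩ := exists_isLift ω d ε M {a}
  rw [Set.biUnion_singleton] at hr
  have hin : ∀ x ∈ initParts ω d ε M a, x ∈ LinearMap.range φ₀ :=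
    fun x hx => hr ▸ Submodule.subset_span hx
  rw [← compSub_inMod hM] at hr
  have hlin := h.linRes hd L'.ini_hom hr
  have hφ : LinearMap.range φ = compSub d M a := by
    apply le_antisymm
    · refine range_le_of_single fun l => Submodule.subset_span ⟨hle ⟨_, rfl⟩, ?_⟩
      have := L'.hom l
      rw [show d'' l = a from hd l] at this
      exact isHomog_iff.mpr this
    · refine Submodule.span_le.mpr fun f hf => ?_
      obtain ⟨w, hw⟩ := exists_mem_Fil ω ε f
      obtain ⟨c, -, -, hc⟩ := L'.exists_rep hle hin hf.1 (isHomog_iff.mp hf.2) hw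
      exact ⟨c, hc⟩
  have hkey : LinearMap.ker φ₀ ≤ inMod ω ε'' (LinearMap.ker φ) := by
    refine (hlin.ker hd L'.ini_hom hr hk).le_compSub.trans (Submodule.span_le.mpr ?_)
    rintro y ⟨hy0, hya⟩
    refine mem_of_wcomp_mem ω ε'' fun w => ?_
    have hyw : WHom ω ε'' w (wcomp ω ε'' w y) := WHom_wcomp
    replace hya : WHom 1 d'' (a + 1) (wcomp ω ε'' w y) := (isHomog_iff.mp hya).wcomp
    replace hy0 : φ₀ (wcomp ω ε'' w y) = 0 := by
      rw [← wcomp_map L'.ini_whom, LinearMap.mem_ker.mp hy0, map_zero]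
    generalize wcomp ω ε'' w y = y at *
    obtain ⟨c, hcw, hca, hc⟩ := L.exists_rep hψ.le
      (fun x hx => hψ₀.ge (initParts_subset hx).1) (hle ⟨y, rfl⟩) (hya.map L'.hom)
      (L'.map_mem_Fil_of_ker hyw hy0)
    obtain ⟨α, hα⟩ := exists_lift_of_range_le (hle.trans hψ.ge)
    have hcm : c ∈ maxSub K n r := by
      have hym := map_mem_maxSub α (hya.mem_maxSub_of_lt fun l =>
        Nat.lt_succ_of_le (hd l : d'' l = a).le)
      have := hker (show c - α y ∈ LinearMap.ker ψ by
        rw [LinearMap.mem_ker, map_sub, hc, hα, sub_self])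
      simpa using add_mem this hym
    obtain ⟨e, he, hee⟩ := L.exists_rep_succ hψ L' hle hin hca hcw hcm
    exact mem_inMod_ker_of_map_eq hyw he (hee.trans hc)
  have hgr : IsGradedSub d (compSub d M a) := by
    rw [← hφ]
    rintro _ ⟨c, rfl⟩ b
    rw [homogComp_eq_wcomp, wcomp_map L'.hom]
    exact ⟨_, rfl⟩
  refine LinRes.of_inMod (ω := ω) (ε := ε) hgr ?_
  rwa [← hφ, L'.inMod_range hkey, hr]

end Main

/-- **Corollary 5.6.** Let `M ⊆ F` be graded with `in_{(ω,ε)}(M)`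
componentwise linear. If `β_1(M) = β_1(in_{(ω,ε)}(M))`, then also
`β_0(M) = β_0(in_{(ω,ε)}(M))` and `M` is componentwise linear. -/
theorem componentwise_linear_from_beta1
    {K : Type*} [Field K] {n k : ℕ} (ω : Fin n → ℕ) (d ε : Fin k → ℕ)
    (M : Submodule (A K n) (Fin k → A K n)) (hM : IsGradedSub d M)
    (hin : CompLinear d (inMod ω ε M))
    (hbeta : ∀ (res1 : GFRes d M) (res2 : GFRes d (inMod ω ε M)),
      res1.Minimal → res2.Minimal → res1.rk 1 = res2.rk 1) :
    (∀ (res1 : GFRes d M) (res2 : GFRes d (inMod ω ε M)),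
      res1.Minimal → res2.Minimal → res1.rk 0 = res2.rk 0) ∧
    CompLinear d M := by
  obtain ⟨r, d', ε', ψ, ψ₀, L, -, hle, hr, hk⟩ := exists_isLift ω d ε M Set.univ
  rw [Set.biUnion_univ, span_iUnion_initParts hM] at hr
  have hψ := L.range_eq hM hle hr.ge
  obtain ⟨res1, h1⟩ := hM.exists_minimal_gfres
  obtain ⟨res2, h2⟩ := (hM.inMod (ω := ω) (ε := ε)).exists_minimal_gfres
  have hker := L.ker_le_maxSub hψ hr hk h1 (hbeta res1 res2 h1 h2)
  refine ⟨fun res1 res2 h1 h2 => ?_, fun a => ?_⟩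
  · rw [h1.rk_zero_eq hψ hker, h2.rk_zero_eq hr hk]
  · exact (hin a).imp compSub_eq_bot (regLE_compSub hM L hψ hr hker)

end CregPaper
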